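/- Let l ≥ 1 be an integer and define τ(s) := det[ I_{j+k+1}(√s) ]_{j,k=0,…,l−1} for s > 0. Then τ(s) ≠ 0 for all s > 0, and the function v(s) := −l²/2 + s/4 − s τ′(s)/τ(s) satisfies the σ-Painlevé III′ equation (s v″(s))² + v′(s)(4v′(s) − 1)(v(s) − s v′(s)) − l²/16 = 0 for all s > 0, together with the small-s behaviour v(s) = −l² + s/8 + O(s²) as s → 0⁺. -/

import Mathlib

open Real Asymptotics

/-- Modified Bessel function of the first kind,
`I_ν(x) := Σ_{k=0}^∞ (x/2)^{ν+2k}/(k! Γ(ν+k+1))`. -/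
noncomputable def besselI (ν : ℝ) (x : ℝ) : ℝ :=
  ∑' k : ℕ, (x / 2) ^ (ν + 2 * (k : ℝ)) / ((k.factorial : ℝ) * Real.Gamma (ν + (k : ℝ) + 1))

/-- `τ(s) := det[I_{j+k+1}(√s)]_{j,k=0,…,l−1}`. -/
noncomputable def tauHankel (l : ℕ) (s : ℝ) : ℝ :=
  Matrix.det (fun j k : Fin l => besselI (((j : ℕ) : ℝ) + ((k : ℕ) : ℝ) + 1) (Real.sqrt s))

/-- `v(s) := −l²/2 + s/4 − s τ′(s)/τ(s)`. -/
noncomputable def vPIII (l : ℕ) (s : ℝ) : ℝ :=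
  -((l : ℝ) ^ 2) / 2 + s / 4 - s * deriv (tauHankel l) s / tauHankel l s

section Aux

open Matrix


theorem core_alg (u ud : ℕ → ℝ → ℝ)
    (hu0 : ∀ t, u 0 t = 0) (hud0 : ∀ t, ud 0 t = 0)
    (hd : ∀ n, ∀ t > 0, HasDerivAt (u n) (ud n t) t)
    (hT : ∀ n, ∀ t > 0, HasDerivAt (ud n) (ud n t * (u (n+1) t - 2 * u n t + u (n-1) t)) t)
    (hne : ∀ n, ∀ t > 0, ud (n+1) t ≠ 0)
    (base : ∀ t > 0, t * ud 1 t + t * (u 1 t)^2 + 2 * u 1 t = 1) :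
    ∀ n : ℕ,
      (∀ t > 0, t * (ud n t + ud (n+1) t) + t * (u (n+1) t - u n t)^2 + 2 * (n+1) * u (n+1) t
          - 2 * n * u n t = 1)
      ∧ (∀ t > 0, t^2 * ud n t * (t * (u (n+1) t - u (n-1) t) + 2 * n)
          = - n * (t * (1 - 2 * (u n t + t * ud n t)) + 2 * (t^2 * ud n t)))
      ∧ (∀ t > 0, 4 * (t^2 * ud n t * (t * (u (n+1) t - u n t) + 2 * n + 1)^2
          + n * (t * (1 - 2 * (u n t + t * ud n t))) * (t * (u (n+1) t - u n t) + 2 * n + 1))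
          = t^2 - (t * (1 - 2 * (u n t + t * ud n t)))^2) := by
  intro n
  induction n with
  | zero =>
    refine ⟨fun t ht => ?_, fun t ht => ?_, fun t ht => ?_⟩
    · simp [hu0, hud0]; linarith [base t ht]
    · simp [hu0, hud0]
    · simp [hu0, hud0]
  | succ n ih =>
    obtain ⟨hR, h2, h1⟩ := ih
    -- J2 at level n+1 from the derivative of Ric n
    have h2' : ∀ t > 0, t^2 * ud (n+1) t * (t * (u (n+1+1) t - u (n+1-1) t) + 2 * ((n:ℝ)+1))
          = - ((n:ℝ)+1) * (t * (1 - 2 * (u (n+1) t + t * ud (n+1) t)) + 2 * (t^2 * ud (n+1) t)) := by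
      intro t ht
      have e1 := ((((hasDerivAt_id t).mul ((hT n t ht).add (hT (n+1) t ht))).add
        ((hasDerivAt_id t).mul (((hd (n+1) t ht).sub (hd n t ht)).pow 2))).add
        ((hd (n+1) t ht).const_mul (2 * ((n:ℝ)+1)))).sub ((hd n t ht).const_mul (2 * (n:ℝ)))
      have e2 : HasDerivAt (fun _ : ℝ => (1:ℝ)) 0 t := hasDerivAt_const t 1
      have e3 := e1.unique (e2.congr_of_eventuallyEq (by
        filter_upwards [lt_mem_nhds ht] with s hs
        have := hR s hs
        simp
        linarith))
      simp at e3
      have hr := hR t ht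
      have h2t := h2 t ht
      simp only [Nat.add_sub_cancel]
      generalize u n t = b at *
      generalize ud n t = b1 at *
      generalize u (n+1) t = c at *
      generalize ud (n+1) t = c1 at *
      generalize u (n-1) t = a at *
      generalize u (n+1+1) t = d at *
      linear_combination t^2 * e3 + h2t - t * hr
    have hR' : ∀ t > 0, t * (ud (n+1) t + ud (n+1+1) t) + t * (u (n+1+1) t - u (n+1) t)^2
          + 2 * ((n:ℝ)+1+1) * u (n+1+1) t - 2 * ((n:ℝ)+1) * u (n+1) t = 1 := by
      intro t ht
      have e1 := ((((hasDerivAt_id t).pow 2).mul (hT (n+1) t ht)).mul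
        ((((hasDerivAt_id t).mul ((hd (n+1+1) t ht).sub (hd n t ht)))).add_const
          (2 * ((n:ℝ)+1)))).add
        (((hasDerivAt_id t).mul (((hd (n+1) t ht).const_mul 2).const_sub 1)).const_mul ((n:ℝ)+1))
      have e2 : HasDerivAt (fun _ : ℝ => (0:ℝ)) 0 t := hasDerivAt_const t 0
      have e3 := e1.unique (e2.congr_of_eventuallyEq (by
        filter_upwards [lt_mem_nhds ht] with s hs
        have := h2' s hs
        simp at this ⊢
        linarith))
      simp at e3
      have hr := hR t ht
      have h2t' := h2' t ht
      have hn := hne n t ht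
      simp only [Nat.add_sub_cancel] at h2t'
      generalize u n t = b at *
      generalize ud n t = b1 at *
      generalize u (n+1) t = c at *
      generalize ud (n+1) t = c1 at *
      generalize u (n+1+1) t = d at *
      generalize ud (n+1+1) t = d1 at *
      have ht' : t ^ 3 * c1 ≠ 0 := by positivity
      apply mul_left_cancel₀ ht'
      linear_combination t * e3 + t^3 * c1 * hr - h2t'
    refine ⟨by exact_mod_cast hR', by exact_mod_cast h2', fun t ht => ?_⟩
    have hr := hR t ht
    have h2t := h2 t ht
    have h2t' := h2' t ht
    have h1t := h1 t ht
    have hn := hne n t ht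
    simp only [Nat.add_sub_cancel] at h2t'
    push_cast
    generalize u n t = b at *
    generalize ud n t = b1 at *
    generalize u (n+1) t = c at *
    generalize ud (n+1) t = c1 at *
    generalize u (n-1) t = a at *
    generalize u (n+1+1) t = d at *
    have hX : 4 * (t^2 * c1 * (t * (c - b) + 2 * n + 1)^2
          + (n+1) * (t * (1 - 2 * (c + t * c1))) * (t * (c - b) + 2 * n + 1))
          = t^2 - (t * (1 - 2 * (c + t * c1)))^2 := by
      have hc : t * c1 = 1 - t * b1 - t * (c-b)^2 - 2*(n+1)*c + 2*n*b := by linear_combination hr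
      have hc' : t^2 * c1 = t * (1 - t * b1 - t * (c-b)^2 - 2*(n+1)*c + 2*n*b) := by
        linear_combination t * hr
      rw [hc', hc]
      linear_combination h1t
    linear_combination hX + 4 * ((t * (d - c) + 2 * (n+1) + 1) - (t * (c - b) + 2 * n + 1)) * h2t'


noncomputable def bg (n : ℕ) (t : ℝ) : ℝ :=
  ∑' k : ℕ, t ^ k / ((k.factorial : ℝ) * ((n + k).factorial : ℝ))

theorem bg_summable (n : ℕ) (t : ℝ) :
    Summable fun k : ℕ => t ^ k / ((k.factorial : ℝ) * ((n + k).factorial : ℝ)) := by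
  refine Summable.of_norm_bounded (Real.summable_pow_div_factorial |t|) fun k => ?_
  rw [norm_div, norm_pow, Real.norm_eq_abs, Real.norm_of_nonneg (by positivity)]
  have h1 : (1:ℝ) ≤ ((n+k).factorial : ℝ) := by exact_mod_cast Nat.factorial_pos _
  have h2 : (0:ℝ) < (k.factorial : ℝ) := by positivity
  gcongr
  nlinarith

theorem bg_hasDerivAt (n : ℕ) (t : ℝ) : HasDerivAt (bg n) (bg (n+1) t) t := by
  have key : bg (n+1) t = ∑' k : ℕ, (k : ℝ) * t ^ (k-1) / ((k.factorial : ℝ) * ((n + k).factorial : ℝ)) := by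
    rw [← (Function.Injective.tsum_eq (g := Nat.succ) Nat.succ_injective)]
    · apply tsum_congr
      intro k
      simp only [Nat.succ_eq_add_one, Nat.add_sub_cancel]
      rw [show n + 1 + k = n + (k+1) by ring, Nat.factorial_succ k]
      push_cast
      field_simp
      try ring
    · intro k hk
      rcases k with _ | k
      · simp at hk
      · exact ⟨k, rfl⟩
  rw [key]
  have hs : Summable fun k : ℕ => (|t|+1) ^ (k-1) / ((k-1).factorial : ℝ) := by
    refine (summable_nat_add_iff 1).1 ?_
    simpa using Real.summable_pow_div_factorial (|t|+1)
  change HasDerivAt (fun z : ℝ => ∑' k : ℕ, z ^ k / ((k.factorial : ℝ) * ((n + k).factorial : ℝ))) _ t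
  refine hasDerivAt_tsum_of_isPreconnected (t := Metric.ball 0 (|t|+1)) (y₀ := t) (y := t)
    (g' := fun k s => (k : ℝ) * s ^ (k-1) / ((k.factorial : ℝ) * ((n + k).factorial : ℝ)))
    (g := fun k s => s ^ k / ((k.factorial : ℝ) * ((n + k).factorial : ℝ))) hs Metric.isOpen_ball
    (convex_ball _ _).isPreconnected (fun k s _ => ?_) (fun k s hs' => ?_) ?_ (bg_summable n t) ?_
  · exact (hasDerivAt_pow k s).div_const _
  · rcases k with _ | k
    · simp
    · have h1 : (1:ℝ) ≤ ((n+(k+1)).factorial : ℝ) := by exact_mod_cast Nat.factorial_pos _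
      have hs2 : |s| ≤ |t| + 1 := by
        have := mem_ball_zero_iff.1 hs'
        exact this.le
      have h3 : |s| ^ k ≤ (|t|+1)^k := by gcongr
      have h2 : (0:ℝ) < (k.factorial : ℝ) := by positivity
      have e : ((k+1:ℕ):ℝ) * s ^ k / (((k+1).factorial : ℝ) * ((n + (k+1)).factorial : ℝ))
          = s ^ k / ((k.factorial : ℝ) * ((n + (k+1)).factorial : ℝ)) := by
        rw [Nat.factorial_succ k]
        push_cast
        field_simp
      simp only [Nat.add_sub_cancel]
      rw [e, norm_div, norm_pow, Real.norm_eq_abs, Real.norm_of_nonneg (by positivity)]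
      gcongr
      nlinarith
  · simp
  · simp

theorem bg_rec (n : ℕ) (t : ℝ) : t * bg (n+2) t + (n+1) * bg (n+1) t = bg n t := by
  have h1 : t * bg (n+2) t = ∑' k : ℕ, (k : ℝ) * t ^ k / ((k.factorial : ℝ) * ((n + 1 + k).factorial : ℝ)) := by
    rw [← (Function.Injective.tsum_eq (g := Nat.succ) Nat.succ_injective)]
    · rw [bg, ← tsum_mul_left]
      apply tsum_congr
      intro k
      simp only [Nat.succ_eq_add_one]
      rw [show n + 1 + (k+1) = n + 2 + k by ring, Nat.factorial_succ k]
      push_cast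
      field_simp
      try ring
    · intro k hk
      rcases k with _ | k
      · simp at hk
      · exact ⟨k, rfl⟩
  have hs1 : Summable fun k : ℕ => (k : ℝ) * t ^ k / ((k.factorial : ℝ) * ((n + 1 + k).factorial : ℝ)) := by
    refine (summable_nat_add_iff 1).1 ?_
    refine ((bg_summable (n+2) t).mul_left t).congr fun k => ?_
    rw [show n + 1 + (k+1) = n + 2 + k by ring, Nat.factorial_succ k]
    push_cast
    field_simp
    ring
  rw [h1, bg, ← tsum_mul_left, ← Summable.tsum_add hs1 ((bg_summable (n+1) t).mul_left _), bg]
  apply tsum_congr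
  intro k
  rw [show n + 1 + k = (n+k) + 1 by ring, Nat.factorial_succ (n+k)]
  push_cast
  field_simp
  ring

theorem bg_contDiff (m n : ℕ) : ContDiff ℝ m (bg n) := by
  induction m generalizing n with
  | zero =>
    rw [Nat.cast_zero, contDiff_zero]
    exact continuous_iff_continuousAt.2 fun t => (bg_hasDerivAt n t).continuousAt
  | succ m ih =>
    rw [Nat.cast_succ, contDiff_succ_iff_deriv]
    refine ⟨fun t => (bg_hasDerivAt n t).differentiableAt, by simp, ?_⟩
    rw [show deriv (bg n) = bg (n+1) from funext fun t => (bg_hasDerivAt n t).deriv]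
    exact ih _

theorem bg_pos (n : ℕ) (t : ℝ) (ht : 0 ≤ t) : 0 < bg n t := by
  refine (bg_summable n t).tsum_pos (fun k => by positivity) 0 (by simp; positivity)

theorem hasDerivAt_det {ι : Type*} [Fintype ι] [DecidableEq ι] (A : ℝ → Matrix ι ι ℝ)
    (A' : Matrix ι ι ℝ) (t : ℝ) (h : ∀ i j, HasDerivAt (fun s => A s i j) (A' i j) t) :
    HasDerivAt (fun s => (A s).det) (∑ i, ((A t).updateCol i (fun j => A' j i)).det) t := by
  have h1 : HasDerivAt (fun s => ∑ σ : Equiv.Perm ι, (Equiv.Perm.sign σ : ℝ) * ∏ i, A s (σ i) i)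
      (∑ σ : Equiv.Perm ι, (Equiv.Perm.sign σ : ℝ) *
        ∑ i, (∏ j ∈ Finset.univ.erase i, A t (σ j) j) • A' (σ i) i) t := by
    refine HasDerivAt.fun_sum fun σ _ => HasDerivAt.const_mul _ ?_
    exact HasDerivAt.fun_finsetProd (fun i _ => h (σ i) i)
  have h2 : (fun s => (A s).det) =
      fun s => ∑ σ : Equiv.Perm ι, (Equiv.Perm.sign σ : ℝ) * ∏ i, A s (σ i) i := by
    funext s
    rw [Matrix.det_apply']
  rw [h2]
  convert h1 using 1
  simp_rw [Matrix.det_apply', Finset.mul_sum]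
  rw [Finset.sum_comm]
  refine Finset.sum_congr rfl fun σ _ => Finset.sum_congr rfl fun i _ => ?_
  rw [← Finset.mul_prod_erase Finset.univ _ (Finset.mem_univ i)]
  rw [Matrix.updateCol_self, smul_eq_mul, mul_comm (A' _ _)]
  congr 2
  refine Finset.prod_congr rfl fun j hj => ?_
  rw [Matrix.updateCol_ne (Finset.ne_of_mem_erase hj)]

noncomputable def HH (m : ℕ) (t : ℝ) : Matrix (Fin m) (Fin m) ℝ :=
  Matrix.of fun j k => bg ((j:ℕ) + (k:ℕ) + 1) t

noncomputable def DD (m : ℕ) (t : ℝ) : ℝ := (HH m t).det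

noncomputable def ww (m : ℕ) (t : ℝ) : Fin (m+1) → ℝ := fun j => bg ((j:ℕ) + m + 2) t

noncomputable def NN (m : ℕ) (i : Fin (m+1)) (t : ℝ) : ℝ :=
  ((HH (m+1) t).updateCol i (ww m t)).det

theorem contDiff_det {ι : Type*} [Fintype ι] [DecidableEq ι] (N : ℕ) (A : ℝ → Matrix ι ι ℝ)
    (h : ∀ i j, ContDiff ℝ N (fun s => A s i j)) : ContDiff ℝ N (fun s => (A s).det) := by
  simp_rw [Matrix.det_apply']
  exact ContDiff.sum fun σ _ => contDiff_const.mul (contDiff_prod fun i _ => h _ _)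

theorem DD_contDiff (N m : ℕ) : ContDiff ℝ N (DD m) :=
  contDiff_det N _ fun _ _ => bg_contDiff N _

theorem NN_contDiff (N m : ℕ) (i : Fin (m+1)) : ContDiff ℝ N (NN m i) := by
  refine contDiff_det N _ fun j k => ?_
  by_cases hk : k = i
  · subst hk
    simp only [Matrix.updateCol_self]
    exact bg_contDiff N _
  · simp only [Matrix.updateCol_ne hk]
    exact bg_contDiff N _

theorem DD_zero (t : ℝ) : DD 0 t = 1 := by simp [DD]

theorem DD_one (t : ℝ) : DD 1 t = bg 1 t := by simp [DD, HH]

theorem DD_hasDerivAt (m : ℕ) (t : ℝ) : HasDerivAt (DD (m+1)) (NN m (Fin.last m) t) t := by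
  have h := hasDerivAt_det (HH (m+1)) (Matrix.of fun j k => bg ((j:ℕ) + (k:ℕ) + 1 + 1) t) t
    (fun i j => bg_hasDerivAt _ t)
  change HasDerivAt (fun s => (HH (m+1) s).det) _ t
  convert h using 1
  rw [Fin.sum_univ_castSucc, Finset.sum_eq_zero, zero_add]
  · rw [NN]
    congr 1
  · intro i _
    have hne : (Fin.castSucc i) ≠ i.succ := by
      intro h
      have := congrArg Fin.val h
      simp at this
    refine Matrix.det_zero_of_column_eq hne fun k => ?_
    rw [Matrix.updateCol_self, Matrix.updateCol_ne hne.symm]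
    simp [HH]
    congr 1

theorem cram (m : ℕ) (t : ℝ) (j : Fin (m+1)) :
    ∑ k : Fin (m+1), bg ((j:ℕ) + (k:ℕ) + 1) t * NN m k t = DD (m+1) t * bg ((j:ℕ) + m + 2) t := by
  have h := congrFun (Matrix.mulVec_cramer (HH (m+1) t) (ww m t)) j
  simpa [Matrix.mulVec, dotProduct, Matrix.cramer_apply, HH, ww, DD, NN] using h

theorem adj_last (m : ℕ) (t : ℝ) :
    (HH (m+1) t).adjugate (Fin.last m) (Fin.last m) = DD m t := by
  rw [Matrix.adjugate_fin_succ_eq_det_submatrix]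
  simp only [Fin.val_last, Even.add_self, Even.neg_pow, one_pow, one_mul]
  rw [DD]
  congr 1
  ext i j
  simp [HH]

theorem adj_row (m : ℕ) (t : ℝ) (k : Fin (m+1)) :
    ∑ j : Fin (m+1), (HH (m+1) t).adjugate (Fin.last m) j * bg ((j:ℕ) + (k:ℕ) + 1) t
      = if k = Fin.last m then DD (m+1) t else 0 := by
  have h := congrFun (congrFun (Matrix.adjugate_mul (HH (m+1) t)) (Fin.last m)) k
  rw [Matrix.mul_apply] at h
  simp only [HH, Matrix.of_apply, Matrix.smul_apply, Matrix.one_apply, smul_eq_mul] at h ⊢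
  rw [h]
  by_cases hk : k = Fin.last m
  · subst hk; simp [DD, HH]
  · simp [hk, Ne.symm hk]

theorem schur (m : ℕ) (t : ℝ) :
    DD (m+1) t * (DD (m+1) t * bg (2*m+3) t - ∑ k : Fin (m+1), bg (m + (k:ℕ) + 2) t * NN m k t)
      = DD (m+2) t * DD (m+1) t := by
  set z : Fin (m+2) → ℝ := Fin.snoc (fun k => NN m k t) (- DD (m+1) t) with hz
  have h1 : HH (m+2) t *ᵥ z = Pi.single (Fin.last (m+1))
      (∑ k : Fin (m+1), bg (m + (k:ℕ) + 2) t * NN m k t - DD (m+1) t * bg (2*m+3) t) := by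
    ext j
    rw [Matrix.mulVec, dotProduct, Fin.sum_univ_castSucc]
    refine Fin.lastCases ?_ (fun j => ?_) j
    · simp only [hz, Fin.snoc_castSucc, Fin.snoc_last, HH, Matrix.of_apply, Fin.val_last,
        Fin.val_castSucc, Pi.single_eq_same]
      rw [show m + 1 + (m+1) + 1 = 2*m+3 by ring]
      have : ∀ k : ℕ, m + 1 + k + 1 = m + k + 2 := fun k => by ring
      simp only [this]
      ring
    · simp only [hz, Fin.snoc_castSucc, Fin.snoc_last, HH, Matrix.of_apply, Fin.val_last,
        Fin.val_castSucc]
      rw [cram, Pi.single_eq_of_ne (Fin.castSucc_lt_last j).ne,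
        show (j:ℕ) + (m+1) + 1 = j + m + 2 by ring]
      ring
  have h2 : (HH (m+2) t).adjugate *ᵥ (HH (m+2) t *ᵥ z) = DD (m+2) t • z := by
    rw [Matrix.mulVec_mulVec, Matrix.adjugate_mul, Matrix.smul_mulVec, Matrix.one_mulVec, DD]
  have h3 := congrFun h2 (Fin.last (m+1))
  rw [h1, Matrix.mulVec_single] at h3
  simp only [hz, Pi.smul_apply, Matrix.col_apply, Fin.snoc_last, adj_last, smul_eq_mul,
    MulOpposite.smul_eq_mul_unop, MulOpposite.unop_op] at h3
  linear_combination -h3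

theorem toda (m : ℕ) (t : ℝ) (h0 : ∀ s > 0, DD (m+1) s ≠ 0) (ht : 0 < t) :
    HasDerivAt (fun s => NN m (Fin.last m) s / DD (m+1) s)
      (DD (m+2) t * DD m t / (DD (m+1) t)^2) t := by
  have hD := h0 t ht
  have hx : ∀ k : Fin (m+1), ∃ x', HasDerivAt (fun s => NN m k s / DD (m+1) s) x' t := fun k =>
    ⟨_, ((((NN_contDiff 1 m k).differentiable (by simp)) t).div
      (((DD_contDiff 1 (m+1)).differentiable (by simp)) t) hD).hasDerivAt⟩
  choose x' hx' using hx
  convert hx' (Fin.last m) using 1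
  have hlin : ∀ s > 0, ∀ j : Fin (m+1),
      ∑ k : Fin (m+1), bg ((j:ℕ) + (k:ℕ) + 1) s * (NN m k s / DD (m+1) s)
        = bg ((j:ℕ) + m + 2) s := by
    intro s hs j
    have h := cram m s j
    simp_rw [← mul_div_assoc]
    rw [← Finset.sum_div, h, mul_div_cancel_left₀ _ (h0 s hs)]
  have hder : ∀ j : Fin (m+1),
      ∑ k : Fin (m+1), (bg ((j:ℕ) + (k:ℕ) + 1 + 1) t * (NN m k t / DD (m+1) t)
        + bg ((j:ℕ) + (k:ℕ) + 1) t * x' k) = bg ((j:ℕ) + m + 2 + 1) t := by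
    intro j
    have e1 : HasDerivAt (fun s => ∑ k : Fin (m+1), bg ((j:ℕ) + (k:ℕ) + 1) s * (NN m k s / DD (m+1) s))
      (∑ k : Fin (m+1), (bg ((j:ℕ) + (k:ℕ) + 1 + 1) t * (NN m k t / DD (m+1) t)
        + bg ((j:ℕ) + (k:ℕ) + 1) t * x' k)) t :=
      HasDerivAt.fun_sum fun k _ => (bg_hasDerivAt _ t).mul (hx' k)
    refine e1.unique ((bg_hasDerivAt _ t).congr_of_eventuallyEq ?_)
    filter_upwards [lt_mem_nhds ht] with s hs
    exact hlin s hs j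
  have hbr : ∀ j : Fin (m+1), ∑ k : Fin (m+1), bg ((j:ℕ) + (k:ℕ) + 1) t * x' k
      = if j = Fin.last m then DD (m+2) t / DD (m+1) t else 0 := by
    intro j
    have hj := hder j
    rw [Finset.sum_add_distrib] at hj
    refine Fin.lastCases (motive := fun j => (∑ k : Fin (m+1), bg ((j:ℕ) + (k:ℕ) + 1 + 1) t * (NN m k t / DD (m+1) t)
        + ∑ k : Fin (m+1), bg ((j:ℕ) + (k:ℕ) + 1) t * x' k = bg ((j:ℕ) + m + 2 + 1) t) →
        ∑ k : Fin (m+1), bg ((j:ℕ) + (k:ℕ) + 1) t * x' k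
      = if j = Fin.last m then DD (m+2) t / DD (m+1) t else 0) ?_ (fun i => ?_) j hj
    · intro hj
      have hs := schur m t
      have hs' := mul_left_cancel₀ hD (hs.trans (mul_comm _ _))
      simp only [Fin.val_last, if_true] at hj ⊢
      rw [← hs', eq_div_iff hD]
      rw [show m + m + 2 + 1 = 2*m+3 by ring] at hj
      rw [← hj]
      simp_rw [← mul_div_assoc]
      rw [← Finset.sum_div]
      simp only [show ∀ k : ℕ, m + k + 1 + 1 = m + k + 2 from fun k => rfl]
      field_simp
      ring
    · intro hj
      rw [if_neg (Fin.castSucc_lt_last i).ne]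
      have := hlin t ht i.succ
      simp only [Fin.val_succ, Fin.val_castSucc] at this hj ⊢
      rw [show (i:ℕ) + 1 + m + 2 = i + m + 2 + 1 by ring] at this
      simp only [show ∀ k : ℕ, (i:ℕ) + 1 + k + 1 = i + k + 1 + 1 from fun k => by ring] at this
      linarith
  have key : ∑ j : Fin (m+1), (HH (m+1) t).adjugate (Fin.last m) j *
      ∑ k : Fin (m+1), bg ((j:ℕ) + (k:ℕ) + 1) t * x' k = DD (m+1) t * x' (Fin.last m) := by
    simp_rw [Finset.mul_sum]
    rw [Finset.sum_comm]
    simp_rw [← mul_assoc, ← Finset.sum_mul, adj_row]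
    simp
  simp_rw [hbr] at key
  simp [adj_last] at key
  field_simp
  field_simp at key
  linear_combination key

theorem wsum (n : ℕ) (t : ℝ) (ht : 0 ≤ t) (q : Polynomial ℝ) :
    Summable fun b : ℕ => t ^ b / ((b.factorial : ℝ) * ((b+n).factorial : ℝ)) * q.eval (b:ℝ) := by
  simp_rw [Polynomial.eval_eq_sum_range, Finset.mul_sum]
  refine summable_sum fun i _ => ?_
  refine Summable.of_norm_bounded
    ((Real.summable_pow_div_factorial (t * exp 1)).mul_left (|q.coeff i| * (i.factorial : ℝ))) fun b => ?_
  have h1 : (1:ℝ) ≤ ((b+n).factorial : ℝ) := by exact_mod_cast Nat.factorial_pos _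
  have h2 : (0:ℝ) < (b.factorial : ℝ) := by positivity
  have h3 : (0:ℝ) < (i.factorial : ℝ) := by positivity
  have h4 : (b:ℝ)^i ≤ i.factorial * (exp 1)^b := by
    have := Real.pow_div_factorial_le_exp (b:ℝ) (by positivity) i
    rw [div_le_iff₀ h3] at this
    rw [← Real.exp_nat_mul, mul_one]
    linarith
  rw [norm_mul, norm_mul, Real.norm_of_nonneg (by positivity),
    Real.norm_of_nonneg (by positivity : (0:ℝ) ≤ (b:ℝ)^i), Real.norm_eq_abs]
  have h5 : t ^ b / ((b.factorial : ℝ) * ((b+n).factorial : ℝ)) ≤ t ^ b / (b.factorial : ℝ) := by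
    gcongr
    nlinarith
  calc _ ≤ t ^ b / (b.factorial : ℝ) * (|q.coeff i| * (i.factorial * (exp 1)^b)) := by gcongr
    _ = _ := by rw [mul_pow]; ring

noncomputable def S1 : Polynomial.Sequence ℝ where
  elems' := descPochhammer ℝ
  degree_eq' i := by
    rw [Polynomial.degree_eq_natDegree (monic_descPochhammer ℝ i).ne_zero,
      descPochhammer_natDegree]

noncomputable def S2 (n : ℕ) : Polynomial.Sequence ℝ where
  elems' i := (descPochhammer ℝ i).comp (Polynomial.X + Polynomial.C (n:ℝ))
  degree_eq' i := by
    have : ((descPochhammer ℝ i).comp (Polynomial.X + Polynomial.C (n:ℝ))).Monic :=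
      (monic_descPochhammer ℝ i).comp_X_add_C _
    rw [Polynomial.degree_eq_natDegree this.ne_zero, Polynomial.natDegree_comp,
      descPochhammer_natDegree, Polynomial.natDegree_X_add_C, mul_one]

theorem S1_eval (i b : ℕ) : (S1 i).eval (b:ℝ) = (b.descFactorial i : ℝ) :=
  descPochhammer_eval_eq_descFactorial ℝ b i

theorem S2_eval (n i b : ℕ) : (S2 n i).eval (b:ℝ) = ((b+n).descFactorial i : ℝ) := by
  have := descPochhammer_eval_eq_descFactorial ℝ (b+n) i
  simp only [S2, Polynomial.eval_comp, Polynomial.eval_add, Polynomial.eval_X, Polynomial.eval_C]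
  rw [← this]
  push_cast
  rfl

theorem S2_eval' (n b j : ℕ) (hj : j < n) :
    (S2 n (n-1-j)).eval (b:ℝ) / ((b+n).factorial : ℝ) = 1 / ((b+1+j).factorial : ℝ) := by
  rw [S2_eval]
  have h := Nat.factorial_mul_descFactorial (show n-1-j ≤ b+n by omega)
  rw [show b + n - (n-1-j) = b+1+j by omega] at h
  rw [div_eq_div_iff (by positivity) (by positivity)]
  have h' : ((b+1+j).factorial : ℝ) * ((b+n).descFactorial (n-1-j) : ℝ) = ((b+n).factorial : ℝ) := by
    exact_mod_cast h
  linarith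

theorem bg_moment (n j k : ℕ) (hj : j < n) (t : ℝ) :
    t ^ k * bg (j+k+1) t = ∑' b : ℕ, t ^ b / ((b.factorial : ℝ) * ((b+n).factorial : ℝ)) *
      ((S1 k).eval (b:ℝ) * (S2 n (n-1-j)).eval (b:ℝ)) := by
  rw [← (Function.Injective.tsum_eq (g := fun m => m + k) (add_left_injective k))]
  · rw [bg, ← tsum_mul_left]
    refine tsum_congr fun m => ?_
    have h2 := S2_eval' n (m+k) j hj
    have h1 := Nat.factorial_mul_descFactorial (show k ≤ m + k by omega)
    rw [Nat.add_sub_cancel] at h1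
    have h1' : (m.factorial : ℝ) * ((m+k).descFactorial k : ℝ) = ((m+k).factorial : ℝ) := by
      exact_mod_cast h1
    rw [S1_eval]
    rw [show t ^ (m+k) / (((m+k).factorial : ℝ) * ((m+k+n).factorial : ℝ)) *
      (((m+k).descFactorial k : ℝ) * (S2 n (n-1-j)).eval ((m+k:ℕ):ℝ)) =
      t ^ (m+k) / ((m+k).factorial : ℝ) * ((m+k).descFactorial k : ℝ) *
        ((S2 n (n-1-j)).eval ((m+k:ℕ):ℝ) / ((m+k+n).factorial : ℝ)) by ring, h2, ← h1']
    rw [show j + k + 1 + m = m + k + 1 + j by ring]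
    have : ((m+k).descFactorial k : ℝ) ≠ 0 := by
      intro h0
      rw [h0, mul_zero] at h1'
      exact (Nat.cast_ne_zero.2 (Nat.factorial_ne_zero _)) h1'.symm
    field_simp
    ring
  · intro b hb
    by_cases hbk : k ≤ b
    · exact ⟨b - k, by simp [hbk]⟩
    · exfalso
      apply hb
      simp only [S1_eval]
      rw [Nat.descFactorial_eq_zero_iff_lt.2 (by omega)]
      simp

theorem DD_ne (n : ℕ) (t : ℝ) (ht : 0 ≤ t) : DD n t ≠ 0 := by
  intro h0
  obtain ⟨v, hv, hvM⟩ := Matrix.exists_vecMul_eq_zero_iff.2 h0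
  have hk : ∀ k : Fin n, ∑ j : Fin n, v j * bg ((j:ℕ) + (k:ℕ) + 1) t = 0 := fun k => by
    have := congrFun hvM k
    simpa [Matrix.vecMul, dotProduct, HH] using this
  set p : Polynomial ℝ := ∑ j : Fin n, v j • S2 n (n-1-(j:ℕ)) with hp
  have hpeval : ∀ x : ℝ, p.eval x = ∑ j : Fin n, v j * (S2 n (n-1-(j:ℕ))).eval x := fun x => by
    simp [hp, Polynomial.eval_finsetSum]
  have hpdeg : p ∈ Polynomial.degreeLT ℝ n := by
    refine Submodule.sum_mem _ fun j _ => Submodule.smul_mem _ _ ?_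
    rw [Polynomial.mem_degreeLT, Polynomial.Sequence.degree_eq]
    have := j.2
    exact_mod_cast (by omega : n - 1 - (j:ℕ) < n)
  have hroot : ∀ k : Fin n, p.eval ((k:ℕ):ℝ) = 0 := by
    rcases ht.eq_or_lt with h | h
    · intro k
      subst h
      have hb0 : ∀ m : ℕ, bg m 0 = 1 / (m.factorial : ℝ) := fun m => by
        rw [bg, tsum_eq_single 0]
        · simp
        · intro b hb; simp [hb]
      have h1 := hk k
      rw [hpeval]
      have h2 : (∑ j : Fin n, v j * (S2 n (n-1-(j:ℕ))).eval ((k:ℕ):ℝ)) / (((k:ℕ)+n).factorial : ℝ) = 0 := by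
        rw [← h1, Finset.sum_div]
        refine Finset.sum_congr rfl fun j _ => ?_
        rw [mul_div_assoc, S2_eval' n k j j.2, hb0, show (k:ℕ) + 1 + j = j + k + 1 by ring]
      rcases div_eq_zero_iff.1 h2 with h3 | h3
      · exact h3
      · exact absurd h3 (by positivity)
    · have hL : ∀ q ∈ Polynomial.degreeLT ℝ n, ∑' b : ℕ, t ^ b / ((b.factorial : ℝ) *
          ((b+n).factorial : ℝ)) * ((q * p).eval (b:ℝ)) = 0 := by
        intro q hq
        rw [← S1.span_degreeLT (fun i _ => by
          rw [isUnit_iff_ne_zero, Polynomial.leadingCoeff_ne_zero]; exact S1.ne_zero i)] at hq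
        induction hq using Submodule.span_induction with
        | mem q hq =>
          obtain ⟨k, hk', rfl⟩ := hq
          have h1 := hk ⟨k, hk'⟩
          have h2 : t ^ k * ∑ j : Fin n, v j * bg ((j:ℕ) + k + 1) t = 0 := by rw [h1, mul_zero]
          rw [Finset.mul_sum] at h2
          rw [← h2]
          have h3 : ∀ j : Fin n, t ^ k * (v j * bg ((j:ℕ) + k + 1) t) =
            ∑' b : ℕ, t ^ b / ((b.factorial : ℝ) * ((b+n).factorial : ℝ)) *
              (v j • (S1 k * S2 n (n-1-(j:ℕ)))).eval (b:ℝ) := fun j => by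
            rw [mul_left_comm, bg_moment n j k j.2 t, ← tsum_mul_left]
            refine tsum_congr fun b => ?_
            rw [Polynomial.eval_smul, Polynomial.eval_mul, smul_eq_mul]
            ring
          rw [Finset.sum_congr rfl (fun j _ => h3 j), ← Summable.tsum_finsetSum]
          · refine tsum_congr fun b => ?_
            rw [← Finset.mul_sum, Polynomial.eval_mul, hpeval, Finset.mul_sum]
            congr 1
            refine Finset.sum_congr rfl fun j _ => ?_
            rw [Polynomial.eval_smul, Polynomial.eval_mul, smul_eq_mul]
            ring
          · intro j _
            exact wsum n t ht _
        | zero => simp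
        | add x y _ _ hx hy =>
          have hxy := Summable.tsum_add (wsum n t ht (x * p)) (wsum n t ht (y * p))
          rw [hx, hy, add_zero] at hxy
          rw [← hxy]
          refine tsum_congr fun b => ?_
          simp only [Polynomial.eval_mul, Polynomial.eval_add]
          ring
        | smul a x _ hx =>
          rw [← mul_zero a, ← hx, ← tsum_mul_left]
          refine tsum_congr fun b => ?_
          simp only [Polynomial.eval_mul, Polynomial.eval_smul, smul_eq_mul]
          ring
      have hpp := hL p hpdeg
      intro k
      have hnn : ∀ b : ℕ, 0 ≤ t ^ b / ((b.factorial : ℝ) *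
          ((b+n).factorial : ℝ)) * ((p * p).eval (b:ℝ)) := fun b => by
        rw [Polynomial.eval_mul]
        exact mul_nonneg (by positivity) (mul_self_nonneg _)
      have hz := (hasSum_zero_iff_of_nonneg hnn).1 (hpp ▸ (wsum n t ht (p*p)).hasSum)
      have := congrFun hz (k:ℕ)
      simp only [Pi.zero_apply, Polynomial.eval_mul] at this
      rcases mul_eq_zero.1 this with h3 | h3
      · exact absurd h3 (by positivity)
      · exact mul_self_eq_zero.1 h3
  have hp0 : p = 0 := by
    refine Polynomial.eq_zero_of_degree_lt_of_eval_index_eq_zero (s := (Finset.univ : Finset (Fin n)))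
      (v := fun k : Fin n => ((k:ℕ):ℝ)) ?_ ?_ (fun k _ => hroot k)
    · intro a _ b _ hab
      have hab' : ((a:ℕ):ℝ) = ((b:ℕ):ℝ) := hab
      exact Fin.ext (by exact_mod_cast hab')
    · simpa using Polynomial.mem_degreeLT.1 hpdeg
  have hli : LinearIndependent ℝ (fun j : Fin n => S2 n (n-1-(j:ℕ))) := by
    refine (S2 n).linearIndependent.comp (fun j : Fin n => n-1-(j:ℕ)) ?_
    intro a b hab
    have := a.2
    have := b.2
    simp only at hab
    exact Fin.ext (by omega)
  exact hv (funext (Fintype.linearIndependent_iff.1 hli v hp0))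

noncomputable def uu (n : ℕ) (t : ℝ) : ℝ := deriv (DD n) t / DD n t

noncomputable def rr : ℕ → ℝ → ℝ
  | 0 => fun _ => 0
  | m+1 => fun t => DD (m+2) t * DD m t / (DD (m+1) t)^2

theorem uu_zero (t : ℝ) : uu 0 t = 0 := by
  have : DD 0 = fun _ => 1 := funext DD_zero
  simp [uu, this]

theorem uu_succ (m : ℕ) : uu (m+1) = fun s => NN m (Fin.last m) s / DD (m+1) s :=
  funext fun s => by rw [uu, (DD_hasDerivAt m s).deriv]

theorem DD_diff (m : ℕ) : Differentiable ℝ (DD m) := (DD_contDiff 1 m).differentiable (by simp)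

theorem DD_hasDerivAt' (m : ℕ) (t : ℝ) (ht : 0 ≤ t) :
    HasDerivAt (DD m) (uu m t * DD m t) t := by
  rw [uu, div_mul_cancel₀ _ (DD_ne m t ht)]
  exact (DD_diff m t).hasDerivAt

theorem uu_diff (n : ℕ) (t : ℝ) (ht : 0 ≤ t) : DifferentiableAt ℝ (uu n) t := by
  rcases n with _ | m
  · rw [show uu 0 = fun _ => 0 from funext uu_zero]
    exact differentiableAt_const _
  · rw [uu_succ]
    exact ((NN_contDiff 1 m _).differentiable (by simp) t).div (DD_diff _ t) (DD_ne _ t ht)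

theorem rr_cont (n : ℕ) (t : ℝ) (ht : 0 ≤ t) : ContinuousAt (rr n) t := by
  rcases n with _ | m
  · exact continuousAt_const
  · exact (((DD_diff _ t).mul (DD_diff _ t)).div ((DD_diff _ t).pow 2)
      (pow_ne_zero 2 (DD_ne _ t ht))).continuousAt

theorem uu_hasDerivAt (n : ℕ) (t : ℝ) (ht : 0 < t) : HasDerivAt (uu n) (rr n t) t := by
  rcases n with _ | m
  · rw [show uu 0 = fun _ => 0 from funext uu_zero]
    exact hasDerivAt_const _ _
  · rw [uu_succ]
    exact toda m t (fun s hs => DD_ne _ s hs.le) ht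

theorem rr_hasDerivAt (n : ℕ) (t : ℝ) (ht : 0 < t) :
    HasDerivAt (rr n) (rr n t * (uu (n+1) t - 2 * uu n t + uu (n-1) t)) t := by
  rcases n with _ | m
  · simpa [rr] using hasDerivAt_const t (0:ℝ)
  · have h := ((DD_hasDerivAt' (m+2) t ht.le).mul (DD_hasDerivAt' m t ht.le)).div
      ((DD_hasDerivAt' (m+1) t ht.le).pow 2) (pow_ne_zero 2 (DD_ne _ t ht.le))
    have hD := DD_ne (m+1) t ht.le
    refine HasDerivAt.congr_deriv (f := rr (m+1)) h ?_
    change _ = DD (m+2) t * DD m t / (DD (m+1) t)^2 * (uu (m+2) t - 2 * uu (m+1) t + uu m t)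
    simp only [Pi.mul_apply, Pi.pow_apply]
    field_simp
    ring

theorem rr_ne (m : ℕ) (t : ℝ) (ht : 0 < t) : rr (m+1) t ≠ 0 :=
  div_ne_zero (mul_ne_zero (DD_ne _ t ht.le) (DD_ne _ t ht.le)) (pow_ne_zero 2 (DD_ne _ t ht.le))

theorem base_ric (t : ℝ) (ht : 0 < t) : t * rr 1 t + t * (uu 1 t)^2 + 2 * uu 1 t = 1 := by
  have hb := (bg_pos 1 t ht.le).ne'
  have hD1 : DD 1 = bg 1 := funext DD_one
  have hu : uu 1 = fun s => bg 2 s / bg 1 s := by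
    funext s
    rw [uu, hD1, (bg_hasDerivAt 1 s).deriv]
  have h1 := uu_hasDerivAt 1 t ht
  rw [hu] at h1
  have h2 := h1.unique ((bg_hasDerivAt 2 t).div (bg_hasDerivAt 1 t) hb)
  have h3 := bg_rec 1 t
  rw [h2, hu]
  norm_num at h3 ⊢
  field_simp
  linear_combination bg 1 t * h3

theorem sigma_t (n : ℕ) (t : ℝ) (ht : 0 < t) :
    (2 * t * rr n t + t^2 * (rr n t * (uu (n+1) t - 2 * uu n t + uu (n-1) t)))^2
      = n^2 * (1 - 2 * (uu n t + t * rr n t))^2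
        + rr n t * (t^2 - t^2 * (1 - 2 * (uu n t + t * rr n t))^2) := by
  obtain ⟨-, h2, h1⟩ := core_alg uu rr uu_zero (fun t => rfl) uu_hasDerivAt rr_hasDerivAt
    rr_ne base_ric n
  have h2 := h2 t ht
  have h1 := h1 t ht
  generalize uu n t = b at *
  generalize rr n t = r at *
  generalize uu (n+1) t = c at *
  generalize uu (n-1) t = a at *
  have e : t * (2 * t * r + t^2 * (r * (c - 2 * b + a))) =
      2 * (t^2 * r) * (t * (c - b) + 2 * n + 1) + n * (t * (1 - 2 * (b + t * r))) := by
    linear_combination -h2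
  apply mul_left_cancel₀ (pow_ne_zero 2 ht.ne')
  rw [← mul_pow, e]
  linear_combination t^2 * r * h1

theorem uu_at_zero (n : ℕ) (hn : 1 ≤ n) : uu n 0 = 1/2 := by
  have cu : ∀ k, ContinuousAt (uu k) 0 := fun k => (uu_diff k 0 le_rfl).continuousAt
  have cr : ContinuousAt (rr n) 0 := rr_cont n 0 le_rfl
  have ci : ContinuousAt (fun t : ℝ => t) 0 := continuousAt_id
  have c1 : ContinuousAt (fun t => (2 * t * rr n t + t^2 * (rr n t * (uu (n+1) t - 2 * uu n t + uu (n-1) t)))^2) 0 :=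
    (((continuousAt_const.mul ci).mul cr).add ((ci.pow 2).mul (cr.mul (((cu _).sub
      (continuousAt_const.mul (cu _))).add (cu _))))).pow 2
  have ce : ContinuousAt (fun t => (1 - 2 * (uu n t + t * rr n t))^2) 0 :=
    (continuousAt_const.sub (continuousAt_const.mul ((cu n).add (ci.mul cr)))).pow 2
  have c2 : ContinuousAt (fun t => (n:ℝ)^2 * (1 - 2 * (uu n t + t * rr n t))^2
        + rr n t * (t^2 - t^2 * (1 - 2 * (uu n t + t * rr n t))^2)) 0 :=
    (continuousAt_const.mul ce).add (cr.mul ((ci.pow 2).sub ((ci.pow 2).mul ce)))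
  have l1 := c1.tendsto.mono_left (nhdsWithin_le_nhds (s := Set.Ioi 0))
  have l2 := c2.tendsto.mono_left (nhdsWithin_le_nhds (s := Set.Ioi 0))
  have l1' := l1.congr' (by
    filter_upwards [self_mem_nhdsWithin] with t ht
    exact sigma_t n t ht)
  have := tendsto_nhds_unique l1' l2
  have hn' : (n:ℝ) ≠ 0 := by positivity
  simp at this
  rcases this with h | h
  · omega
  · linarith

theorem besselI_eq (n : ℕ) (s : ℝ) (hs : 0 < s) :
    besselI (n:ℝ) (√s) = (√s / 2)^n * bg n (s/4) := by
  rw [besselI, bg, ← tsum_mul_left]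
  refine tsum_congr fun k => ?_
  rw [show (n:ℝ) + 2 * (k:ℝ) = ((n + 2 * k : ℕ) : ℝ) by push_cast; ring, Real.rpow_natCast,
    show (n:ℝ) + (k:ℝ) + 1 = ((n + k : ℕ) : ℝ) + 1 by push_cast; ring, Real.Gamma_nat_eq_factorial,
    pow_add, pow_mul, div_pow (√s) 2 2, Real.sq_sqrt hs.le, mul_div_assoc]
  norm_num

theorem tau_eq (l : ℕ) (s : ℝ) (hs : 0 < s) :
    tauHankel l s = (√s / 2)^(l^2) * DD l (s/4) := by
  set x := √s / 2 with hx
  have h1 : tauHankel l s = Matrix.det (Matrix.of fun j k : Fin l =>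
      x^(j:ℕ) * (Matrix.of fun j k : Fin l => x^((k:ℕ)+1) * HH l (s/4) j k) j k) := by
    rw [tauHankel]
    congr 1
    ext j k
    have := besselI_eq ((j:ℕ) + (k:ℕ) + 1) s hs
    push_cast at this
    simp only [Matrix.of_apply, HH]
    rw [this]
    ring
  rw [h1, Matrix.det_mul_column, Matrix.det_mul_row, ← mul_assoc, ← Finset.prod_mul_distrib, DD]
  congr 1
  simp_rw [← pow_add]
  rw [Finset.prod_pow_eq_pow_sum, Fin.sum_univ_eq_sum_range (fun i => i + (i+1)) l]
  congr 1
  clear h1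
  induction l with
  | zero => simp
  | succ l ih => rw [Finset.sum_range_succ, ih]; ring

theorem v_eq (l : ℕ) (s : ℝ) (hs : 0 < s) :
    vPIII l s = -(l:ℝ)^2 + s/4 - s/4 * uu l (s/4) := by
  have hq : 0 < √s := Real.sqrt_pos.2 hs
  have hd4 : HasDerivAt (fun y : ℝ => y / 4) (1/4) s := (hasDerivAt_id s).div_const 4
  have h0 : HasDerivAt (fun y => DD l (y/4)) (uu l (s/4) * DD l (s/4) * (1/4)) s :=
    HasDerivAt.comp s (h := fun y : ℝ => y / 4) (DD_hasDerivAt' l (s/4) (by positivity)) hd4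
  have h1 : HasDerivAt (fun y => (√y / 2)^(l^2) * DD l (y/4)) _ s :=
    (((Real.hasDerivAt_sqrt hs.ne').div_const 2).pow (l^2)).mul h0
  have h2 := h1.congr_of_eventuallyEq (f₁ := tauHankel l) (by
    filter_upwards [lt_mem_nhds hs] with y hy
    exact tau_eq l y hy)
  have hD := DD_ne l (s/4) (by positivity)
  rw [vPIII, h2.deriv, tau_eq l s hs]
  have hp : ((l^2 : ℕ):ℝ) * (√s/2)^(l^2-1) * (√s/2) = ((l^2:ℕ):ℝ) * (√s/2)^(l^2) := by
    generalize l^2 = N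
    rcases N with _ | N
    · simp
    · rw [Nat.add_sub_cancel, pow_succ]; ring
  have hs2 : s * (1 / (2 * √s) / 2) = (√s/2)/2 := by
    have := Real.mul_self_sqrt hs.le
    field_simp
    nlinarith
  have hx : (√s/2)^(l^2) ≠ 0 := by positivity
  have key : s * (((l^2 : ℕ):ℝ) * (√s/2)^(l^2-1) * (1 / (2 * √s) / 2) * DD l (s/4)
      + (√s/2)^(l^2) * (uu l (s/4) * DD l (s/4) * (1/4))) =
      ((l:ℝ)^2/2 + s/4 * uu l (s/4)) * ((√s/2)^(l^2) * DD l (s/4)) := by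
    have e : s * (((l^2 : ℕ):ℝ) * (√s/2)^(l^2-1) * (1 / (2 * √s) / 2)) =
        ((l^2 : ℕ):ℝ) * (√s/2)^(l^2) / 2 := by
      rw [← hp]
      linear_combination (((l^2 : ℕ):ℝ) * (√s/2)^(l^2-1)) * hs2
    push_cast at e ⊢
    linear_combination DD l (s/4) * e
  have key' := (div_eq_iff (mul_ne_zero hx hD)).2 key
  simp only [Pi.pow_apply]
  rw [key']
  ring

end Aux

/-- `τ(s) ≠ 0` for `s > 0`; `v(s) = −l²/2 + s/4 − sτ′/τ` satisfies the σ-Painlevé III′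
equation `(sv″)² + v′(4v′ − 1)(v − sv′) − l²/16 = 0` on `(0,∞)`, with the small-`s`
behaviour `v(s) = −l² + s/8 + O(s²)` as `s → 0⁺`. -/
theorem sigma_PIII_for_hankel (l : ℕ) (hl : 1 ≤ l) :
    (∀ s : ℝ, 0 < s → tauHankel l s ≠ 0)
    ∧ (∀ s : ℝ, 0 < s →
        (s * iteratedDeriv 2 (vPIII l) s) ^ 2
          + deriv (vPIII l) s * (4 * deriv (vPIII l) s - 1)
              * (vPIII l s - s * deriv (vPIII l) s)
          - (l : ℝ) ^ 2 / 16 = 0)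
    ∧ (fun s : ℝ => vPIII l s - (-(l : ℝ) ^ 2 + s / 8))
        =O[nhdsWithin 0 (Set.Ioi 0)] (fun s : ℝ => s ^ 2) := by
  have hd4 : ∀ s : ℝ, HasDerivAt (fun y : ℝ => y / 4) (1/4) s := fun s =>
    (hasDerivAt_id s).div_const 4
  refine ⟨fun s hs => ?_, fun s hs => ?_, ?_⟩
  · rw [tau_eq l s hs]
    have : 0 < √s := Real.sqrt_pos.2 hs
    exact mul_ne_zero (by positivity) (DD_ne l _ (by positivity))
  · have hu : ∀ y : ℝ, 0 < y → HasDerivAt (fun y => uu l (y/4)) (rr l (y/4) * (1/4)) y :=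
      fun y hy => HasDerivAt.comp y (h := fun y : ℝ => y / 4) (uu_hasDerivAt l (y/4) (by positivity)) (hd4 y)
    have hv1 : ∀ y : ℝ, 0 < y → HasDerivAt (vPIII l)
        (1/4 - (1/4 * uu l (y/4) + y/4 * (rr l (y/4) * (1/4)))) y := by
      intro y hy
      refine HasDerivAt.congr_of_eventuallyEq (f := fun y => -(l:ℝ)^2 + y/4 - y/4 * uu l (y/4)) ?_ ?_
      · exact ((hd4 y).const_add _).sub ((hd4 y).mul (hu y hy))
      · filter_upwards [lt_mem_nhds hy] with z hz
        exact v_eq l z hz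
    have hr : HasDerivAt (fun y => rr l (y/4)) _ s :=
      HasDerivAt.comp s (h := fun y : ℝ => y / 4) (rr_hasDerivAt l (s/4) (by positivity)) (hd4 s)
    have hv2 := (((hu s hs).const_mul (1/4)).add ((hd4 s).mul (hr.mul_const (1/4)))).const_sub (1/4)
    have hv2' := (hv2.congr_of_eventuallyEq (f₁ := deriv (vPIII l)) (by
      filter_upwards [lt_mem_nhds hs] with z hz
      exact (hv1 z hz).deriv)).deriv
    rw [iteratedDeriv_succ, iteratedDeriv_one, hv2', (hv1 s hs).deriv, v_eq l s hs]
    have hσ := sigma_t l (s/4) (by positivity)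
    linear_combination (1/16) * hσ
  · have h0 := (uu_diff l 0 le_rfl).hasDerivAt.isBigO_sub
    rw [uu_at_zero l hl] at h0
    have ht : Filter.Tendsto (fun s : ℝ => s/4) (nhdsWithin 0 (Set.Ioi 0)) (nhds 0) := by
      have : Filter.Tendsto (fun s : ℝ => s/4) (nhds 0) (nhds (0/4)) := (hd4 0).continuousAt
      rw [zero_div] at this
      exact this.mono_left nhdsWithin_le_nhds
    have h1 := h0.comp_tendsto ht
    have hid : (fun s : ℝ => s / 4) =O[nhdsWithin 0 (Set.Ioi 0)] (fun s : ℝ => s) := by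
      simpa [div_eq_mul_inv, mul_comm] using
        (isBigO_refl (fun s : ℝ => s) (nhdsWithin 0 (Set.Ioi 0))).const_mul_left (4⁻¹ : ℝ)
    have h2 := hid.mul (h1.trans (by simpa [Function.comp_def] using hid))
    have h3 := h2.neg_left
    refine (h3.congr' ?_ ?_)
    · filter_upwards [self_mem_nhdsWithin] with s hs
      rw [v_eq l s hs]
      simp only [Function.comp_apply]
      ring
    · filter_upwards with s
      ring
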